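/- Let K, L ∈ ℕ with L > K, let α ∈ 𝒞_{K,L} with associated sequence (n_k), and let f(x) = -log x - log(1-x) + g(x) with g ∈ C³(𝕋), g > 0. There exist k₀ ∈ ℕ and b₀ > 0 such that for every k ≥ k₀ and b ≥ b₀: if x ∈ 𝕋 satisfies |S_{q_{n_k}}(f)(x) − c_k| ≥ b, then for every i ∈ {−L, −L+1, …, −1, 1, …, L} one has |S_{q_{n_k}}(f)(R_α^{i·q_{n_k}} x) − c_k| ≤ b/(2L), where x_k = 1/(2q_{n_k}) and c_k = S_{q_{n_k}}(f)(x_k). -/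

import Mathlib

open MeasureTheory Filter Topology

noncomputable section

/-- Iterates of the Gauss map applied to the fractional part of `α`. -/
def gaussIter (α : ℝ) (n : ℕ) : ℝ := (fun x : ℝ => Int.fract x⁻¹)^[n] (Int.fract α)

/-- The `n`-th partial quotient `a_n` of the continued fraction expansion of `α`
(for `n ≥ 1`). -/
def cfA (α : ℝ) (n : ℕ) : ℕ := ⌊(gaussIter α (n - 1))⁻¹⌋₊

/-- The denominators `q_n` of the convergents of the continued fraction of `α`:
`q₀ = 1`, `q₁ = a₁`, `q_{n+1} = a_{n+1} q_n + q_{n-1}`. -/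
def cfQ (α : ℝ) : ℕ → ℕ
  | 0 => 1
  | 1 => cfA α 1
  | n + 2 => cfA α (n + 2) * cfQ α (n + 1) + cfQ α n

/-- Birkhoff sums over the rotation by `α`: `S_n(φ)(x) = ∑_{i<n} φ(x + iα)`. -/
def birkhoffRot (α : ℝ) (φ : ℝ → ℝ) (n : ℕ) (x : ℝ) : ℝ :=
  ∑ i ∈ Finset.range n, φ (x + i * α)

/-- Distance to the nearest integer, `‖x‖ = min(x mod 1, 1 - x mod 1)`. -/
def distNearestInt (x : ℝ) : ℝ := min (Int.fract x) (1 - Int.fract x)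

/-- `h(x) = -log x - log(1-x)`, read on the circle. -/
def symLog (x : ℝ) : ℝ := -Real.log (Int.fract x) - Real.log (1 - Int.fract x)

/-- The roof `f(x) = -log x - log(1-x) + g(x)`, read on the circle. -/
def symLogRoof (g : ℝ → ℝ) (x : ℝ) : ℝ := symLog x + g x

/-- The set `A_k(b) = {x ∈ 𝕋 : |S_q(f)(x) - c_k| ≥ b}` where `q = q_{n_k}` and
`c_k = S_q(f)(x_k)` with `x_k = 1/(2q)` (here `𝕋` is represented by `[0,1)`). -/
def AkSet (α : ℝ) (g : ℝ → ℝ) (q : ℕ) (b : ℝ) : Set ℝ :=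
  {x | x ∈ Set.Ico (0 : ℝ) 1 ∧
    b ≤ |birkhoffRot α (symLogRoof g) q x
          - birkhoffRot α (symLogRoof g) q (1 / (2 * (q : ℝ)))|}

/-- The map `j ↦ g + j p` permutes the residues modulo `q`, with inverse `v ↦ a (v - g)` when
`a p ≡ 1`. -/
lemma sum_range_emod_eq {q : ℕ} (hq : 0 < q) {a p : ℤ} (g : ℤ) (hap : a * p ≡ 1 [ZMOD q])
    (F : ℤ → ℤ → ℝ) :
    ∑ j ∈ Finset.range q, F j ((g + j * p) % q) =
      ∑ v ∈ Finset.range q, F ((a * (v - g)) % q) v := by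
  have hq' : (0 : ℤ) < q := by exact_mod_cast hq
  have key : ∀ x : ℤ, ((x % (q : ℤ)).toNat : ℤ) = x % q := fun x =>
    Int.toNat_of_nonneg (Int.emod_nonneg _ hq'.ne')
  have small : ∀ j : ℕ, j < q → (j : ℤ) % q = j := fun j hj =>
    Int.emod_eq_of_lt (by positivity) (by exact_mod_cast hj)
  have inv1 : ∀ j : ℕ, j < q → (a * ((g + j * p) % q - g)) % q = j := by
    intro j hj
    refine Eq.trans ?_ (small j hj)
    change _ ≡ _ [ZMOD q]
    calc a * ((g + j * p) % q - g) ≡ a * ((g + j * p) - g) [ZMOD q] :=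
          ((Int.mod_modEq _ _).sub_right g).mul_left a
      _ = a * p * j := by ring
      _ ≡ 1 * j [ZMOD q] := hap.mul_right _
      _ = j := one_mul _
  have inv2 : ∀ v : ℕ, v < q → (g + (a * (v - g)) % q * p) % q = v := by
    intro v hv
    refine Eq.trans ?_ (small v hv)
    change _ ≡ _ [ZMOD q]
    calc g + (a * (v - g)) % q * p ≡ g + (a * (v - g)) * p [ZMOD q] :=
          ((Int.mod_modEq _ _).mul_right p).add_left g
      _ = g + a * p * (v - g) := by ring
      _ ≡ g + 1 * (v - g) [ZMOD q] := (hap.mul_right _).add_left g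
      _ = v := by ring
  refine Finset.sum_bij' (fun j _ => ((g + j * p) % q).toNat)
    (fun v _ => ((a * (v - g)) % q).toNat) ?_ ?_ ?_ ?_ ?_
  · intro j _
    have := key (g + j * p)
    have := Int.emod_lt_of_pos (g + j * p) hq'
    simp only [Finset.mem_range]; omega
  · intro v _
    have := key (a * (v - g))
    have := Int.emod_lt_of_pos (a * (v - g)) hq'
    simp only [Finset.mem_range]; omega
  · intro j hj
    simp only [Finset.mem_range] at hj
    zify
    rw [key, key, inv1 j hj]
  · intro v hv
    simp only [Finset.mem_range] at hv
    zify
    rw [key, key, inv2 v hv]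
  · intro j hj
    simp only [Finset.mem_range] at hj
    rw [key, inv1 j hj]

/-- Koksma's inequality for the sawtooth along a full denominator. -/
lemma abs_sum_fract_sub_half_le {Q : ℕ} (hQ : 0 < Q) {P : ℤ} (hP : IsCoprime P (Q : ℤ))
    {β : ℝ} (hβ : |Q * β - P| * Q ≤ 1) (γ : ℝ) :
    |∑ i ∈ Finset.range Q, (Int.fract (γ + i * β) - 1 / 2)| ≤ 6 := by
  have hQ' : (0 : ℝ) < Q := by exact_mod_cast hQ
  have hQz : (0 : ℤ) < Q := by exact_mod_cast hQ
  obtain ⟨a, b, hab⟩ := hP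
  have hap : a * P ≡ 1 [ZMOD Q] := by
    rw [← hab]
    exact (Int.modEq_iff_dvd.2 ⟨b, by ring⟩)
  set g : ℤ := ⌊Q * γ⌋ with hg
  have hsum := fun F : ℤ → ℝ => sum_range_emod_eq hQ g hap (fun _ v => F v)
  set I : ℤ → ℝ := fun v => (if v = 0 then 1 else 0) + (if v = Q - 1 then 1 else 0) +
    (if v = Q - 2 then 1 else 0) with hI
  have hI0 : ∀ v, 0 ≤ I v := by
    intro v; simp only [hI]; positivity
  have hterm : ∀ i ∈ Finset.range Q,
      |Int.fract (γ + i * β) - (((g + i * P) % Q : ℤ) : ℝ) / Q| ≤ 2 / Q + I ((g + i * P) % Q) := by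
    intro i hi
    have hi : (i : ℝ) ≤ Q := by exact_mod_cast (Finset.mem_range.1 hi).le
    set v : ℤ := (g + i * P) % Q with hv
    have hv0 : 0 ≤ v := Int.emod_nonneg _ hQz.ne'
    have hv1 : v < Q := Int.emod_lt_of_pos _ hQz
    have hv0' : (0 : ℝ) ≤ v := by exact_mod_cast hv0
    have hv1' : (v : ℝ) < Q := by exact_mod_cast hv1
    have hdiv : ((g + i * P : ℤ) : ℝ) = Q * ((g + i * P) / Q : ℤ) + v := by
      rw [hv]; exact_mod_cast (Int.mul_ediv_add_emod (g + i * P) Q).symm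
    push_cast at hdiv
    set e : ℝ := (Q * γ - g) + i * (Q * β - P) with he
    have hη : |i * (Q * β - P)| ≤ 1 := by
      rw [abs_mul, Nat.abs_cast]
      calc (i : ℝ) * |Q * β - P| ≤ Q * |Q * β - P| := by gcongr
        _ ≤ 1 := by linarith
    have hη := abs_le.1 hη
    have hκ0 : 0 ≤ Q * γ - g := sub_nonneg.2 (Int.floor_le _)
    have hκ1 : Q * γ - g < 1 := by linarith [Int.lt_floor_add_one (Q * γ)]
    have heq : γ + i * β = (v + e) / Q + ((g + i * P) / Q : ℤ) := by
      field_simp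
      rw [he]; linarith
    rw [heq, Int.fract_add_intCast]
    by_cases hcase : v = 0 ∨ v = Q - 1 ∨ v = Q - 2
    · have hI1 : 1 ≤ I v := by
        simp only [hI]
        rcases hcase with h | h | h
        · rw [if_pos h]
          have : (0 : ℝ) ≤ (if v = Q - 1 then 1 else 0) := by positivity
          have : (0 : ℝ) ≤ (if v = Q - 2 then 1 else 0) := by positivity
          linarith
        · rw [if_pos h]
          have : (0 : ℝ) ≤ (if v = 0 then 1 else 0) := by positivity
          have : (0 : ℝ) ≤ (if v = Q - 2 then 1 else 0) := by positivity
          linarith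
        · rw [if_pos h]
          have : (0 : ℝ) ≤ (if v = Q - 1 then 1 else 0) := by positivity
          have : (0 : ℝ) ≤ (if v = 0 then 1 else 0) := by positivity
          linarith
      have h1 := Int.fract_nonneg ((v + e) / (Q : ℝ))
      have h2 := Int.fract_lt_one ((v + e) / (Q : ℝ))
      have h3 : 0 ≤ (v : ℝ) / Q := by positivity
      have h4 : (v : ℝ) / Q ≤ 1 := by rw [div_le_one hQ']; exact hv1'.le
      have h5 : 0 ≤ 2 / (Q : ℝ) := by positivity
      rw [abs_le]; constructor <;> linarith
    · have hv2 : (1 : ℝ) ≤ v := by exact_mod_cast (by omega : 1 ≤ v)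
      have hv3 : (v : ℝ) ≤ Q - 3 := by exact_mod_cast (by omega : v ≤ Q - 3)
      have : Int.fract ((v + e) / (Q : ℝ)) = (v + e) / Q := by
        rw [Int.fract_eq_self]
        constructor
        · apply div_nonneg _ hQ'.le; linarith
        · rw [div_lt_one hQ']; linarith
      rw [this, ← sub_div, abs_div, abs_of_pos hQ', add_sub_cancel_left]
      have : |e| / Q ≤ 2 / Q := by
        gcongr; rw [abs_le]; constructor <;> linarith
      linarith [hI0 v]
  have hv : ∑ i ∈ Finset.range Q, (((g + i * P) % Q : ℤ) : ℝ) / Q = ((Q : ℝ) - 1) / 2 := by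
    rw [hsum (fun v => (v : ℝ) / Q)]
    have h := Finset.sum_range_id_mul_two Q
    have h' : (∑ i ∈ Finset.range Q, (i : ℝ)) * 2 = Q * (Q - 1) := by
      have := congrArg (Nat.cast : ℕ → ℝ) h
      push_cast [Nat.cast_sub (show 1 ≤ Q from hQ)] at this
      exact this
    push_cast
    rw [← Finset.sum_div]
    field_simp
    linarith
  have hIsum : ∑ i ∈ Finset.range Q, I ((g + i * P) % Q) ≤ 3 := by
    rw [hsum I]
    have aux : ∀ w : ℤ, ∑ v ∈ Finset.range Q, (if (v : ℤ) = w then (1 : ℝ) else 0) ≤ 1 := by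
      intro w
      rw [Finset.sum_boole]
      norm_cast
      rw [Finset.card_le_one]
      intro x hx y hy
      simp only [Finset.mem_filter] at hx hy
      omega
    simp only [hI, Finset.sum_add_distrib]
    linarith [aux 0, aux (Q - 1), aux (Q - 2)]
  have h1 : |∑ i ∈ Finset.range Q,
      (Int.fract (γ + i * β) - (((g + i * P) % Q : ℤ) : ℝ) / Q)| ≤ 5 := by
    refine (Finset.abs_sum_le_sum_abs _ _).trans ((Finset.sum_le_sum hterm).trans ?_)
    rw [Finset.sum_add_distrib, Finset.sum_const, Finset.card_range, nsmul_eq_mul,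
      mul_div_cancel₀ _ hQ'.ne']
    linarith
  rw [Finset.sum_sub_distrib, hv] at h1
  rw [Finset.sum_sub_distrib, Finset.sum_const, Finset.card_range, nsmul_eq_mul]
  rw [abs_le] at h1 ⊢
  constructor <;> linarith

/-- Sums of the sawtooth against `1 / r` along a block of length `Q` gain a factor `1 / Q`. -/
lemma abs_sum_block_le {Q : ℕ} (hQ : 0 < Q) {P : ℤ} (hP : IsCoprime P (Q : ℤ))
    {β : ℝ} (hβ : |Q * β - P| * Q ≤ 1) (γ : ℝ) {R : ℕ} (hR : Q ^ 2 ≤ R) :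
    |∑ r ∈ Finset.Ico R (R + Q), (Int.fract (γ + r * β) - 1 / 2) / r| ≤
      13 / Q * ∑ r ∈ Finset.Ico R (R + Q), 1 / (r : ℝ) := by
  have hQ' : (1 : ℝ) ≤ Q := by exact_mod_cast hQ
  have hR' : (Q : ℝ) ^ 2 ≤ R := by exact_mod_cast hR
  have hR0 : (0 : ℝ) < R := by nlinarith
  have hQR : (Q : ℝ) ≤ R := by nlinarith
  have h1 : |∑ r ∈ Finset.Ico R (R + Q), (Int.fract (γ + r * β) - 1 / 2)| ≤ 6 := by
    rw [Finset.sum_Ico_eq_sum_range, Nat.add_sub_cancel_left]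
    have := abs_sum_fract_sub_half_le hQ hP hβ (γ + R * β)
    convert this using 4 with i
    push_cast
    ring_nf
  have h2 : ∑ r ∈ Finset.Ico R (R + Q), (Int.fract (γ + r * β) - 1 / 2) / r =
      (∑ r ∈ Finset.Ico R (R + Q), (Int.fract (γ + r * β) - 1 / 2)) / R +
      ∑ r ∈ Finset.Ico R (R + Q), (Int.fract (γ + r * β) - 1 / 2) * (1 / r - 1 / R) := by
    rw [Finset.sum_div, ← Finset.sum_add_distrib]
    exact Finset.sum_congr rfl fun r _ => by ring
  have h3 : |∑ r ∈ Finset.Ico R (R + Q), (Int.fract (γ + r * β) - 1 / 2) * (1 / r - 1 / R)| ≤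
      1 / 2 / R := by
    have : ∀ r ∈ Finset.Ico R (R + Q),
        |(Int.fract (γ + r * β) - 1 / 2) * (1 / r - 1 / R)| ≤ 1 / 2 * (Q / R ^ 2) := by
      intro r hr
      rw [Finset.mem_Ico] at hr
      have hr1 : (R : ℝ) ≤ r := by exact_mod_cast hr.1
      have hr2 : (r : ℝ) ≤ R + Q := by exact_mod_cast hr.2.le
      have hr0 : (0 : ℝ) < r := by linarith
      rw [abs_mul]
      have ha : |Int.fract (γ + r * β) - 1 / 2| ≤ 1 / 2 := by
        have := Int.fract_nonneg (γ + r * β)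
        have := Int.fract_lt_one (γ + r * β)
        rw [abs_le]; constructor <;> linarith
      have hb : |1 / (r : ℝ) - 1 / R| ≤ Q / R ^ 2 := by
        rw [div_sub_div _ _ hr0.ne' hR0.ne', abs_div, abs_of_pos (mul_pos hr0 hR0)]
        have : |1 * (R : ℝ) - r * 1| ≤ Q := by rw [abs_le]; constructor <;> linarith
        gcongr
        nlinarith
      gcongr
    refine (Finset.abs_sum_le_sum_abs _ _).trans ((Finset.sum_le_sum this).trans ?_)
    rw [Finset.sum_const, Nat.card_Ico, Nat.add_sub_cancel_left, nsmul_eq_mul]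
    rw [le_div_iff₀ hR0]
    have : (Q : ℝ) * (1 / 2 * (Q / R ^ 2)) * R = 1 / 2 * (Q ^ 2 / R) := by field_simp
    rw [this]
    have : (Q : ℝ) ^ 2 / R ≤ 1 := by rw [div_le_one hR0]; exact hR'
    linarith
  have h4 : 1 / (2 * R : ℝ) * Q ≤ ∑ r ∈ Finset.Ico R (R + Q), 1 / (r : ℝ) := by
    have := Finset.card_nsmul_le_sum (Finset.Ico R (R + Q)) (fun r => 1 / (r : ℝ)) (1 / (2 * R)) ?_
    · rw [Nat.card_Ico, Nat.add_sub_cancel_left, nsmul_eq_mul] at this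
      linarith
    · intro r hr
      rw [Finset.mem_Ico] at hr
      have hr1 : (R : ℝ) ≤ r := by exact_mod_cast hr.1
      have hr2 : (r : ℝ) ≤ R + Q := by exact_mod_cast hr.2.le
      have hr0 : (0 : ℝ) < r := by linarith
      apply one_div_le_one_div_of_le hr0
      linarith
  calc _ ≤ 6 / (R : ℝ) + 1 / 2 / R := by
        rw [h2]
        refine (abs_add_le _ _).trans (add_le_add ?_ h3)
        rw [abs_div, abs_of_pos hR0]
        gcongr
    _ = 13 / Q * (1 / (2 * R : ℝ) * Q) := by field_simp; norm_num
    _ ≤ _ := by gcongr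

lemma abs_sum_Ico_le {Q : ℕ} (hQ : 0 < Q) {P : ℤ} (hP : IsCoprime P (Q : ℤ))
    {β : ℝ} (hβ : |Q * β - P| * Q ≤ 1) (γ : ℝ) (N : ℕ) :
    ∀ A : ℕ, Q ^ 2 ≤ A →
    |∑ r ∈ Finset.Ico A (A + N), (Int.fract (γ + r * β) - 1 / 2) / r| ≤
      13 / Q * ∑ r ∈ Finset.Ico A (A + N), 1 / (r : ℝ) + 1 / Q := by
  have hQ' : (1 : ℝ) ≤ Q := by exact_mod_cast hQ
  induction N using Nat.strong_induction_on with
  | _ N ih =>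
  intro A hA
  by_cases hN : N < Q
  · have hA' : (Q : ℝ) ^ 2 ≤ A := by exact_mod_cast hA
    have hpos : 0 ≤ 13 / Q * ∑ r ∈ Finset.Ico A (A + N), 1 / (r : ℝ) := by positivity
    have : ∀ r ∈ Finset.Ico A (A + N),
        |(Int.fract (γ + r * β) - 1 / 2) / r| ≤ 1 / (Q : ℝ) ^ 2 := by
      intro r hr
      rw [Finset.mem_Ico] at hr
      have hr1 : (A : ℝ) ≤ r := by exact_mod_cast hr.1
      have ha : |Int.fract (γ + r * β) - 1 / 2| ≤ 1 := by
        have := Int.fract_nonneg (γ + r * β)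
        have := Int.fract_lt_one (γ + r * β)
        rw [abs_le]; constructor <;> linarith
      rw [abs_div, Nat.abs_cast]
      gcongr
      linarith
    refine (Finset.abs_sum_le_sum_abs _ _).trans ((Finset.sum_le_sum this).trans ?_)
    rw [Finset.sum_const, Nat.card_Ico, Nat.add_sub_cancel_left, nsmul_eq_mul]
    have hNQ : (N : ℝ) ≤ Q := by exact_mod_cast hN.le
    have : (N : ℝ) * (1 / Q ^ 2) ≤ Q * (1 / Q ^ 2) := by gcongr
    have h2 : (Q : ℝ) * (1 / Q ^ 2) = 1 / Q := by field_simp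
    linarith
  · obtain ⟨M, rfl⟩ := Nat.exists_eq_add_of_le (not_lt.1 hN)
    have h1 := abs_sum_block_le hQ hP hβ γ hA
    have h2 := ih M (by omega) (A + Q) (by omega)
    rw [← add_assoc, ← Finset.sum_Ico_consecutive _ (show A ≤ A + Q by omega)
      (show A + Q ≤ A + Q + M by omega), ← Finset.sum_Ico_consecutive _ (show A ≤ A + Q by omega)
      (show A + Q ≤ A + Q + M by omega), mul_add]
    refine (abs_add_le _ _).trans ?_
    linarith

lemma sum_Ico_one_div_le {A : ℕ} (B : ℕ) (hA : 1 ≤ A) :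
    ∑ r ∈ Finset.Ico A B, 1 / (r : ℝ) ≤ 1 + Real.log B := by
  have h := harmonic_le_one_add_log B
  rw [harmonic_eq_sum_Icc] at h
  push_cast at h
  refine le_trans ?_ h
  simp only [one_div]
  refine Finset.sum_le_sum_of_subset_of_nonneg ?_ fun i _ _ => by positivity
  intro r hr
  simp only [Finset.mem_Ico, Finset.mem_Icc] at *
  omega

/-- The logarithmically weighted sums of the sawtooth are bounded as soon as `β` has rational
approximations whose denominators grow at least geometrically and at most like `exp (c m²)`. -/
lemma exists_bound_sum_fract_div {c : ℝ} (hc : 0 < c) :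
    ∃ C : ℝ, ∀ (β γ : ℝ) (n : ℕ) (Q : ℕ → ℕ) (P : ℕ → ℤ), Q 0 = 1 →
      (∀ m ≤ n, 3 / 4 * (4 / 3 : ℝ) ^ m ≤ Q m) →
      (∀ m ≤ n, (Q m : ℝ) ≤ Real.exp (c * m ^ 2)) →
      (∀ m < n, IsCoprime (P m) (Q m : ℤ)) →
      (∀ m < n, |Q m * β - P m| * Q m ≤ 1) →
      ∀ B ≤ Q n ^ 2, |∑ r ∈ Finset.Ico 1 B, (Int.fract (γ + r * β) - 1 / 2) / r| ≤ C := by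
  set u : ℕ → ℝ := fun i => 4 / 3 * (3 / 4) ^ i * (14 + 26 * c * (i + 1 : ℕ) ^ 2) with hu
  have hu0 : ∀ i, 0 ≤ u i := fun i => by simp only [hu]; positivity
  have hus : Summable u := by
    have h0 := summable_geometric_of_lt_one (r := (3 / 4 : ℝ)) (by norm_num) (by norm_num)
    have h1 := summable_pow_mul_geometric_of_norm_lt_one (R := ℝ) (r := 3 / 4) 2
      (by rw [Real.norm_eq_abs]; norm_num [abs_lt])
    have h2 := (summable_nat_add_iff 1).2 h1
    refine ((h0.mul_left (4 / 3 * 14)).add (h2.mul_left (4 / 3 * (4 / 3) * (26 * c)))).congr ?_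
    intro i
    simp only [hu, pow_succ (3 / 4 : ℝ) i]
    push_cast
    ring
  refine ⟨∑' i, u i, fun β γ n Q P hQ0 hlow hup hcop happ => ?_⟩
  have hpos : ∀ m ≤ n, 0 < Q m := fun m hm => by
    have := hlow m hm
    have h2 : (0 : ℝ) < 3 / 4 * (4 / 3) ^ m := by positivity
    exact_mod_cast h2.trans_le this
  have main : ∀ m ≤ n, ∀ B ≤ Q m ^ 2,
      |∑ r ∈ Finset.Ico 1 B, (Int.fract (γ + r * β) - 1 / 2) / r| ≤
        ∑ i ∈ Finset.range m, u i := by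
    intro m
    induction m with
    | zero =>
      intro _ B hB
      rw [hQ0] at hB
      rw [Finset.Ico_eq_empty_of_le (by omega)]
      simp
    | succ m ih =>
      intro hm B hB
      rw [Finset.sum_range_succ]
      by_cases hBm : B ≤ Q m ^ 2
      · linarith [ih (by omega) B hBm, hu0 m]
      · push Not at hBm
        have hQm := hpos m (by omega)
        have hQm1 : 1 ≤ Q m ^ 2 := Nat.one_le_pow _ _ hQm
        have h1 := ih (by omega) (Q m ^ 2) le_rfl
        obtain ⟨N, rfl⟩ := Nat.exists_eq_add_of_le hBm.le
        have h2 := abs_sum_Ico_le hQm (hcop m (by omega)) (happ m (by omega)) γ N (Q m ^ 2) le_rfl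
        have h3 := sum_Ico_one_div_le (Q m ^ 2 + N) hQm1
        have h4 : Real.log ((Q m ^ 2 + N : ℕ) : ℝ) ≤ 2 * (c * (m + 1 : ℕ) ^ 2) := by
          have hp : (0 : ℝ) < Q (m + 1) := by exact_mod_cast hpos (m + 1) hm
          have : ((Q m ^ 2 + N : ℕ) : ℝ) ≤ (Q (m + 1) : ℝ) ^ 2 := by exact_mod_cast hB
          calc _ ≤ Real.log ((Q (m + 1) : ℝ) ^ 2) :=
                Real.log_le_log (by exact_mod_cast (by omega)) this
            _ = 2 * Real.log (Q (m + 1)) := by rw [Real.log_pow]; norm_num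
            _ ≤ _ := by
                gcongr
                rw [Real.log_le_iff_le_exp hp]
                exact hup _ hm
        rw [← Finset.sum_Ico_consecutive _ hQm1 hBm.le]
        refine (abs_add_le _ _).trans (add_le_add h1 (h2.trans ?_))
        have hQr : (0 : ℝ) < Q m := by exact_mod_cast hQm
        have hinv : 1 / (Q m : ℝ) ≤ 4 / 3 * (3 / 4) ^ m := by
          rw [div_le_iff₀ hQr]
          calc (1 : ℝ) = 4 / 3 * (3 / 4) ^ m * (3 / 4 * (4 / 3) ^ m) := by
                rw [mul_mul_mul_comm, ← mul_pow]; norm_num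
            _ ≤ _ := by gcongr; exact hlow m (by omega)
        calc 13 / (Q m : ℝ) * ∑ r ∈ Finset.Ico (Q m ^ 2) (Q m ^ 2 + N), 1 / (r : ℝ) + 1 / Q m
            = 1 / Q m * (13 * ∑ r ∈ Finset.Ico (Q m ^ 2) (Q m ^ 2 + N), 1 / (r : ℝ) + 1) := by ring
          _ ≤ 1 / Q m * (14 + 26 * c * (m + 1 : ℕ) ^ 2) := mul_le_mul_of_nonneg_left (by linarith) (by positivity)
          _ ≤ u m := by simp only [hu]; gcongr
  intro B hB
  exact (main n le_rfl B hB).trans (hus.sum_le_tsum _ fun i _ => hu0 i)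

lemma gaussIter_succ (α : ℝ) (n : ℕ) :
    gaussIter α (n + 1) = Int.fract (gaussIter α n)⁻¹ :=
  Function.iterate_succ_apply' _ _ _

lemma irrational_gaussIter {α : ℝ} (h : Irrational α) (n : ℕ) : Irrational (gaussIter α n) := by
  have hf : ∀ x : ℝ, Irrational x → Irrational (Int.fract x) := fun x hx => by
    rw [← Int.self_sub_floor]; exact hx.sub_intCast _
  induction n with
  | zero => exact hf α h
  | succ n ih => rw [gaussIter_succ]; exact hf _ ih.inv

lemma gaussIter_lt_one (α : ℝ) (n : ℕ) : gaussIter α n < 1 := by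
  cases n with
  | zero => exact Int.fract_lt_one _
  | succ n => rw [gaussIter_succ]; exact Int.fract_lt_one _

lemma gaussIter_pos {α : ℝ} (h : Irrational α) (n : ℕ) : 0 < gaussIter α n := by
  have h0 : 0 ≤ gaussIter α n := by
    cases n with
    | zero => exact Int.fract_nonneg _
    | succ n => rw [gaussIter_succ]; exact Int.fract_nonneg _
  exact h0.lt_of_ne' (irrational_gaussIter h n).ne_zero

lemma cfA_succ_cast {α : ℝ} (h : Irrational α) (n : ℕ) :
    (cfA α (n + 1) : ℝ) = (gaussIter α n)⁻¹ - gaussIter α (n + 1) := by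
  have := gaussIter_pos h n
  rw [gaussIter_succ, Int.self_sub_fract, cfA, Nat.add_sub_cancel,
    natCast_floor_eq_intCast_floor (by positivity)]

lemma cfA_pos {α : ℝ} (h : Irrational α) (n : ℕ) : 0 < cfA α n := by
  rw [cfA, Nat.floor_pos]
  exact (one_le_inv₀ (gaussIter_pos h _)).2 (gaussIter_lt_one _ _).le

/-- The numerators of the convergents of `α`. -/
def cfP (α : ℝ) : ℕ → ℕ
  | 0 => 0
  | 1 => 1
  | n + 2 => cfA α (n + 2) * cfP α (n + 1) + cfP α n

lemma cfQ_pos {α : ℝ} (h : Irrational α) : ∀ n, 0 < cfQ α n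
  | 0 => Nat.one_pos
  | 1 => cfA_pos h 1
  | n + 2 => by rw [cfQ]; exact Nat.add_pos_right _ (cfQ_pos h n)

lemma le_cfQ {α : ℝ} (h : Irrational α) (n : ℕ) : n ≤ cfQ α n := by
  induction n using Nat.strong_induction_on with
  | _ n ih =>
    match n with
    | 0 => simp
    | 1 => exact cfA_pos h 1
    | n + 2 =>
      rw [cfQ]
      have := ih (n + 1) (by omega)
      have := cfQ_pos h n
      have := Nat.le_mul_of_pos_left (cfQ α (n + 1)) (cfA_pos h (n + 2))
      omega

lemma cfQ_le_succ {α : ℝ} (h : Irrational α) (n : ℕ) : cfQ α n ≤ cfQ α (n + 1) := by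
  cases n with
  | zero => exact cfA_pos h 1
  | succ n =>
    rw [cfQ]
    have := Nat.le_mul_of_pos_left (cfQ α (n + 1)) (cfA_pos h (n + 2))
    omega

lemma cfQ_succ_le {α : ℝ} (h : Irrational α) (n : ℕ) :
    cfQ α (n + 1) ≤ (cfA α (n + 1) + 1) * cfQ α n := by
  cases n with
  | zero => simp [cfQ]
  | succ n =>
    rw [cfQ]
    have := cfQ_le_succ h n
    nlinarith

lemma cfA_mul_cfQ_le (α : ℝ) (n : ℕ) : cfA α (n + 1) * cfQ α n ≤ cfQ α (n + 1) := by
  cases n with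
  | zero => simp [cfQ]
  | succ n => exact Nat.le_add_right _ _

lemma cfQ_mul_cfP_sub (α : ℝ) (n : ℕ) :
    (cfQ α n : ℤ) * cfP α (n + 1) - cfP α n * cfQ α (n + 1) = (-1) ^ n := by
  induction n with
  | zero => simp [cfQ, cfP]
  | succ n ih =>
    rw [cfQ, cfP, pow_succ, ← ih]
    push_cast
    ring

lemma cfQ_mul_sub_cfP_succ {α : ℝ} (h : Irrational α) (hα : α ∈ Set.Ioo (0 : ℝ) 1) (n : ℕ) :
    (cfQ α (n + 1) : ℝ) * α - cfP α (n + 1) =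
      -gaussIter α (n + 1) * (cfQ α n * α - cfP α n) := by
  induction n with
  | zero =>
    have h0 : gaussIter α 0 = α := Int.fract_eq_self.2 ⟨hα.1.le, hα.2⟩
    have := hα.1.ne'
    simp only [cfQ, cfP, cfA_succ_cast h 0, h0]
    push_cast
    field_simp
    ring
  | succ n ih =>
    have hp := (gaussIter_pos h (n + 1)).ne'
    rw [cfQ, cfP]
    push_cast
    rw [cfA_succ_cast h (n + 1)]
    have : (cfQ α n : ℝ) * α - cfP α n =
        -(gaussIter α (n + 1))⁻¹ * (cfQ α (n + 1) * α - cfP α (n + 1)) := by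
      rw [ih]; field_simp
    linear_combination this

lemma abs_cfQ_mul_sub_cfP_mul {α : ℝ} (h : Irrational α) (hα : α ∈ Set.Ioo (0 : ℝ) 1) (n : ℕ) :
    |(cfQ α n : ℝ) * α - cfP α n| * (cfQ α (n + 1) + cfQ α n * gaussIter α (n + 1)) = 1 := by
  have h1 := cfQ_mul_sub_cfP_succ h hα n
  have h2 : (cfQ α n : ℝ) * cfP α (n + 1) - cfP α n * cfQ α (n + 1) = (-1) ^ n := by
    exact_mod_cast cfQ_mul_cfP_sub α n
  have hp := gaussIter_pos h (n + 1)
  have hpos : (0 : ℝ) ≤ cfQ α (n + 1) + cfQ α n * gaussIter α (n + 1) := by positivity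
  rw [← abs_of_nonneg hpos, ← abs_mul]
  have : ((cfQ α n : ℝ) * α - cfP α n) * (cfQ α (n + 1) + cfQ α n * gaussIter α (n + 1)) =
      (-1) ^ n := by
    linear_combination h2 + (cfQ α n : ℝ) * h1
  rw [this, abs_pow, abs_neg, abs_one, one_pow]

lemma abs_cfQ_mul_sub_cfP_le {α : ℝ} (h : Irrational α) (hα : α ∈ Set.Ioo (0 : ℝ) 1) (n : ℕ) :
    |(cfQ α n : ℝ) * α - cfP α n| * cfQ α (n + 1) ≤ 1 := by
  rw [← abs_cfQ_mul_sub_cfP_mul h hα n]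
  have hp := gaussIter_pos h (n + 1)
  gcongr
  exact le_add_of_nonneg_right (by positivity)

/-- If `|m|` is at most half of `q_n`, then `m α` is at distance at least `1 / (2 q_n)` from the
integers. -/
lemma one_div_le_abs_mul_sub {α : ℝ} (h : Irrational α) (hα : α ∈ Set.Ioo (0 : ℝ) 1) {n : ℕ}
    {m : ℤ} (hm0 : m ≠ 0) (hm : 2 * |m| ≤ cfQ α n) (l : ℤ) :
    1 / (2 * (cfQ α n : ℝ)) ≤ |m * α - l| := by
  have hq : (0 : ℝ) < cfQ α n := by exact_mod_cast cfQ_pos h n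
  have hqz : (0 : ℤ) < cfQ α n := by exact_mod_cast cfQ_pos h n
  have hcop : IsCoprime (cfQ α n : ℤ) (cfP α n) := by
    have := cfQ_mul_cfP_sub α n
    rcases neg_one_pow_eq_or ℤ n with h1 | h1 <;> rw [h1] at this
    · exact ⟨cfP α (n + 1), -cfQ α (n + 1), by linear_combination this⟩
    · exact ⟨-cfP α (n + 1), cfQ α (n + 1), by linear_combination -this⟩
  have hne : m * cfP α n - l * cfQ α n ≠ 0 := by
    intro h0
    have hd : (cfQ α n : ℤ) ∣ m * cfP α n := ⟨l, by linear_combination h0⟩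
    have hd := hcop.dvd_of_dvd_mul_right hd
    have := Int.le_of_dvd (abs_pos.2 hm0) ((dvd_abs _ _).2 hd)
    omega
  have hge : (1 : ℝ) ≤ |(m : ℝ) * cfP α n - l * cfQ α n| := by
    exact_mod_cast Int.one_le_abs hne
  have hD := abs_cfQ_mul_sub_cfP_le h hα n
  have hmono : (cfQ α n : ℝ) ≤ cfQ α (n + 1) := by exact_mod_cast cfQ_le_succ h n
  have hmr : 2 * |(m : ℝ)| ≤ cfQ α n := by exact_mod_cast hm
  set D := (cfQ α n : ℝ) * α - cfP α n with hDdef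
  have hmD : |(m : ℝ) * D| ≤ 1 / 2 := by
    rw [abs_mul]
    have := abs_nonneg D
    nlinarith
  have heq : (m * α - l) * cfQ α n = (m * cfP α n - l * cfQ α n) + m * D := by
    rw [hDdef]; ring
  have h3 : 1 / 2 ≤ |((m : ℝ) * α - l) * cfQ α n| := by
    rw [heq]
    have := abs_sub_abs_le_abs_add ((m : ℝ) * cfP α n - l * cfQ α n) (m * D)
    linarith
  rw [abs_mul, abs_of_pos hq] at h3
  rw [div_le_iff₀ (by positivity)]
  linarith

/-- The denominators of the convergents of `[0; a_n, a_{n-1}, …]`. -/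
def revQ (α : ℝ) (n : ℕ) : ℕ → ℕ
  | 0 => 1
  | 1 => cfA α n
  | m + 2 => cfA α (n - (m + 1)) * revQ α n (m + 1) + revQ α n m

/-- The numerators of the convergents of `[0; a_n, a_{n-1}, …]`. -/
def revP (α : ℝ) (n : ℕ) : ℕ → ℕ
  | 0 => 0
  | 1 => 1
  | m + 2 => cfA α (n - (m + 1)) * revP α n (m + 1) + revP α n m

lemma revQ_mul_revP_sub (α : ℝ) (n m : ℕ) :
    (revQ α n m : ℤ) * revP α n (m + 1) - revP α n m * revQ α n (m + 1) = (-1) ^ m := by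
  induction m with
  | zero => simp [revQ, revP]
  | succ m ih =>
    rw [revQ, revP, pow_succ, ← ih]
    push_cast
    ring

lemma isCoprime_revP_revQ (α : ℝ) (n m : ℕ) : IsCoprime (revP α n m : ℤ) (revQ α n m) := by
  have := revQ_mul_revP_sub α n m
  rcases neg_one_pow_eq_or ℤ m with h1 | h1 <;> rw [h1] at this
  · exact ⟨-revQ α n (m + 1), revP α n (m + 1), by linear_combination this⟩
  · exact ⟨revQ α n (m + 1), -revP α n (m + 1), by linear_combination -this⟩

lemma revQ_le_succ {α : ℝ} (h : Irrational α) (n m : ℕ) : revQ α n m ≤ revQ α n (m + 1) := by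
  cases m with
  | zero => exact cfA_pos h n
  | succ m =>
    rw [revQ]
    exact (Nat.le_mul_of_pos_left _ (cfA_pos h _)).trans (Nat.le_add_right _ _)

lemma le_revQ {α : ℝ} (h : Irrational α) (n m : ℕ) :
    3 / 4 * (4 / 3 : ℝ) ^ m ≤ revQ α n m := by
  induction m using Nat.twoStepInduction with
  | zero => norm_num [revQ]
  | one =>
    have : (1 : ℝ) ≤ cfA α n := by exact_mod_cast cfA_pos h n
    rw [revQ]; linarith
  | more m ih _ =>
    have h1 : 2 * revQ α n m ≤ revQ α n (m + 2) := by
      rw [revQ]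
      have := Nat.le_mul_of_pos_left (revQ α n (m + 1)) (cfA_pos h (n - (m + 1)))
      have := revQ_le_succ h n m
      omega
    have h1 : 2 * (revQ α n m : ℝ) ≤ revQ α n (m + 2) := by exact_mod_cast h1
    have : (0 : ℝ) ≤ (4 / 3) ^ m := by positivity
    rw [pow_add]
    linarith

lemma revQ_succ_le {α : ℝ} (h : Irrational α) (n m : ℕ) :
    revQ α n (m + 1) ≤ (cfA α (n - m) + 1) * revQ α n m := by
  cases m with
  | zero => simp [revQ]
  | succ m =>
    rw [revQ]
    have := revQ_le_succ h n m
    linarith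

lemma revQ_le_exp {α c : ℝ} (h : Irrational α) (hc : 0 < c) {n : ℕ}
    (hn : ∀ m : ℕ, 1 ≤ m → m ≤ n → (cfA α (n + 1 - m) : ℝ) ≤ Real.exp (c * m)) (m : ℕ)
    (hm : m ≤ n) : (revQ α n m : ℝ) ≤ Real.exp ((c + 1) * m ^ 2) := by
  induction m with
  | zero => simp [revQ]
  | succ m ih =>
    have h1 : (revQ α n (m + 1) : ℝ) ≤ (cfA α (n - m) + 1) * revQ α n m := by
      exact_mod_cast revQ_succ_le h n m
    have h2 := hn (m + 1) (by omega) hm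
    rw [Nat.add_sub_add_right] at h2
    have h3 : (cfA α (n - m) : ℝ) + 1 ≤ Real.exp ((c + 1) * (m + 1 : ℕ)) := by
      have h4 : (1 : ℝ) ≤ Real.exp (c * (m + 1 : ℕ)) := Real.one_le_exp (by positivity)
      have h5 : (2 : ℝ) ≤ Real.exp (m + 1 : ℕ) := by
        have := Real.add_one_le_exp ((m + 1 : ℕ) : ℝ)
        push_cast at this ⊢
        have : (0 : ℝ) ≤ m := by positivity
        linarith
      rw [add_mul, one_mul, Real.exp_add]
      nlinarith
    calc (revQ α n (m + 1) : ℝ) ≤ (cfA α (n - m) + 1) * revQ α n m := h1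
      _ ≤ Real.exp ((c + 1) * (m + 1 : ℕ)) * Real.exp ((c + 1) * m ^ 2) := by
          gcongr; exact ih (by omega)
      _ = Real.exp ((c + 1) * (m + 1 + m ^ 2)) := by
          rw [← Real.exp_add]; push_cast; ring_nf
      _ ≤ _ := by
          apply Real.exp_le_exp.2
          have : (0 : ℝ) ≤ m := by positivity
          gcongr
          push_cast
          nlinarith

lemma revQ_mul_cfQ_sub (α : ℝ) (n m : ℕ) : ∀ l, m + l + 1 = n →
    (revQ α n m : ℤ) * cfQ α (n - 1) - revP α n m * cfQ α n = (-1) ^ m * cfQ α l := by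
  induction m using Nat.twoStepInduction with
  | zero =>
    rintro l rfl
    simp [revQ, revP]
  | one =>
    rintro l rfl
    rw [show 1 + l + 1 = l + 2 by omega, Nat.add_sub_assoc (by norm_num), revQ, revP, cfQ]
    push_cast
    ring_nf
  | more m ih1 ih2 =>
    rintro l rfl
    have h1 := ih1 (l + 2) (by omega)
    have h2 := ih2 (l + 1) (by omega)
    rw [revQ, revP, show m + 2 + l + 1 - (m + 1) = l + 2 by omega]
    rw [cfQ] at h1
    push_cast at *
    rw [pow_succ] at *
    linear_combination h1 + (cfA α (l + 2) : ℤ) * h2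

lemma revQ_mul_cfQ_add (α : ℝ) (n m : ℕ) : ∀ l, m + l + 2 = n →
    revQ α n (m + 1) * cfQ α (l + 1) + revQ α n m * cfQ α l = cfQ α n := by
  induction m with
  | zero =>
    rintro l rfl
    simp [revQ, cfQ]
  | succ m ih =>
    rintro l rfl
    rw [← ih (l + 1) (by omega), revQ, show m + 1 + l + 2 - (m + 1) = l + 2 by omega, cfQ]
    ring

lemma revQ_mul_cfQ_le {α : ℝ} (h : Irrational α) {n m l : ℕ} (hml : m + l + 1 = n) :
    revQ α n m * cfQ α l ≤ cfQ α n := by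
  cases m with
  | zero =>
    rw [revQ, one_mul, ← hml, zero_add]
    exact cfQ_le_succ h l
  | succ m =>
    rw [← revQ_mul_cfQ_add α n m l (by omega)]
    exact (Nat.mul_le_mul_left _ (cfQ_le_succ h l)).trans (Nat.le_add_right _ _)

/-- Weighted sawtooth sums over the rotation by `± q_{n-1} / q_n` are bounded uniformly in `n`. -/
lemma exists_bound_sum_fract_cfQ {α c : ℝ} (h : Irrational α) (hc : 0 < c) :
    ∃ C : ℝ, ∀ n : ℕ, 2 ≤ n →
      (∀ m : ℕ, 1 ≤ m → m ≤ n → (cfA α (n + 1 - m) : ℝ) ≤ Real.exp (c * m)) →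
      ∀ σ : ℤ, |σ| = 1 → ∀ γ : ℝ, ∀ B ≤ cfQ α n,
        |∑ r ∈ Finset.Ico 1 B,
          (Int.fract (γ + r * ((σ * cfQ α (n - 1) : ℤ) / (cfQ α n : ℝ))) - 1 / 2) / r| ≤ C := by
  obtain ⟨C, hC⟩ := exists_bound_sum_fract_div (c := c + 1) (by linarith)
  refine ⟨C, fun n hn hcf σ hσ γ B hB => ?_⟩
  have hσu : IsUnit σ := Int.isUnit_iff_abs_eq.2 hσ
  refine hC _ γ n (revQ α n) (fun m => σ * revP α n m) rfl (fun m _ => le_revQ h n m)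
    (fun m hm => revQ_le_exp h hc hcf m hm) (fun m _ => ?_) (fun m hm => ?_) B (hB.trans ?_)
  · exact (isCoprime_mul_unit_left_left hσu _ _).2 (isCoprime_revP_revQ α n m)
  · obtain ⟨l, rfl⟩ := Nat.exists_eq_add_of_lt hm
    have hq : (0 : ℝ) < cfQ α (m + l + 1) := by exact_mod_cast cfQ_pos h _
    have h1 : (revQ α (m + l + 1) m : ℝ) * cfQ α (m + l + 1 - 1) -
        revP α (m + l + 1) m * cfQ α (m + l + 1) = (-1) ^ m * cfQ α l := by
      exact_mod_cast revQ_mul_cfQ_sub α _ m l rfl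
    have h2 : (revQ α (m + l + 1) m : ℝ) * cfQ α l ≤ cfQ α (m + l + 1) := by
      exact_mod_cast revQ_mul_cfQ_le h rfl
    have hσr : |(σ : ℝ)| = 1 := by exact_mod_cast hσ
    have h3 : (revQ α (m + l + 1) m : ℝ) *
        ((σ * cfQ α (m + l + 1 - 1) : ℤ) / (cfQ α (m + l + 1) : ℝ)) -
        (σ * revP α (m + l + 1) m : ℤ) = σ * ((-1) ^ m * cfQ α l) / cfQ α (m + l + 1) := by
      rw [← h1]
      push_cast
      field_simp
    rw [h3, abs_div, abs_mul, abs_mul, hσr, abs_pow, abs_neg, abs_one, one_pow, one_mul, one_mul,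
      Nat.abs_cast, Nat.abs_cast, div_mul_eq_mul_div, div_le_one hq]
    linarith
  · obtain ⟨m, rfl⟩ := Nat.exists_eq_add_of_le' hn
    have := revQ_mul_cfQ_add α (m + 2) m 0 rfl
    simp only [cfQ, mul_one] at this
    have h2 : revQ α (m + 2) (m + 2) = cfQ α (m + 2) := by
      rw [revQ, show m + 2 - (m + 1) = 1 by omega, cfQ]
      linarith
    rw [h2]
    exact Nat.le_self_pow two_ne_zero _

lemma symLog_sub_intCast (x : ℝ) (l : ℤ) : symLog (x - l) = symLog x := by
  simp only [symLog, Int.fract_sub_intCast]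

lemma symLog_of_mem {x : ℝ} (hx : x ∈ Set.Ico (0 : ℝ) 1) :
    symLog x = -Real.log x - Real.log (1 - x) := by
  rw [symLog, Int.fract_eq_self.2 hx]

lemma symLog_eq_abs {x : ℝ} (hx0 : x ≠ 0) (hx : |x| < 1) :
    symLog x = -Real.log |x| - Real.log (1 - |x|) := by
  rcases hx0.lt_or_gt with h | h
  · rw [abs_of_neg h] at *
    have : Int.fract x = x + 1 := by
      rw [Int.fract_eq_iff]
      exact ⟨by linarith, by linarith, -1, by push_cast; ring⟩
    rw [symLog, this]
    ring_nf
  · rw [abs_of_pos h] at *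
    exact symLog_of_mem ⟨h.le, hx⟩

lemma abs_symLog_sub_log_le {δ q y : ℝ} (hδ : 0 < δ) (hq : 12 ≤ q) (h1 : δ / q ≤ |y|)
    (h2 : |y| ≤ 6 / q) :
    |symLog y - Real.log q| ≤ Real.log 6 + |Real.log δ| + Real.log 2 := by
  have hq0 : 0 < q := by linarith
  have h3 : 6 / q ≤ 1 / 2 := by rw [div_le_iff₀ hq0]; linarith
  have hy : 0 < |y| := (by positivity : 0 < δ / q).trans_le h1
  rw [symLog_eq_abs (abs_pos.1 hy) (by linarith)]
  have ha := Real.log_le_log (by positivity) h1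
  have hb := Real.log_le_log hy h2
  rw [Real.log_div hδ.ne' hq0.ne'] at ha
  rw [Real.log_div (by norm_num) hq0.ne'] at hb
  have hc := Real.log_le_log (show (0 : ℝ) < 1 / 2 by norm_num) (show 1 / 2 ≤ 1 - |y| by linarith)
  rw [one_div, Real.log_inv] at hc
  have hd := Real.log_nonpos (show 0 ≤ 1 - |y| by linarith) (by linarith)
  have he := neg_abs_le (Real.log δ)
  have hf := abs_nonneg (Real.log δ)
  have hg : 0 ≤ Real.log 6 := Real.log_nonneg (by norm_num)
  have hh : 0 ≤ Real.log 2 := Real.log_nonneg (by norm_num)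
  rw [abs_le]; constructor <;> linarith

lemma abs_log_add_sub_le {w t : ℝ} (hw : 0 < w) (ht : 2 * |t| ≤ w) :
    |Real.log (w + t) - Real.log w - t / w| ≤ 2 * (t / w) ^ 2 := by
  obtain ⟨y, rfl⟩ : ∃ y, t = w * y := ⟨t / w, by field_simp⟩
  rw [abs_mul, abs_of_pos hw] at ht
  have hy : |y| ≤ 1 / 2 := by nlinarith
  have hy := abs_le.1 hy
  rw [mul_div_cancel_left₀ _ hw.ne', show w + w * y = w * (1 + y) by ring,
    Real.log_mul hw.ne' (by linarith), add_sub_cancel_left]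
  have h1 := Real.log_le_sub_one_of_pos (show 0 < 1 + y by linarith)
  have h2 := Real.one_sub_inv_le_log_of_pos (show 0 < 1 + y by linarith)
  have h3 : y - 2 * y ^ 2 ≤ 1 - (1 + y)⁻¹ := by
    have : 1 - (1 + y)⁻¹ = y / (1 + y) := by
      have : 1 + y ≠ 0 := by linarith
      field_simp
      ring
    rw [this, le_div_iff₀ (by linarith)]
    nlinarith [mul_nonneg (sq_nonneg y) (show 0 ≤ 1 + 2 * y by linarith)]
  rw [abs_le]; constructor <;> nlinarith [sq_nonneg y]

/-- First-order expansion of `symLog` at a point `v / q` away from the singularity. -/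
lemma abs_symLog_add_sub_le {q v t : ℝ} (hq : 0 < q) (hv : 4 ≤ v) (hvq : v ≤ q - 4)
    (ht : |t| ≤ 2 / q) :
    |symLog (v / q + t) - symLog (v / q) - t * q * (1 / (q - v) - 1 / v)| ≤
      8 * ((v ^ 2)⁻¹ + ((q - v) ^ 2)⁻¹) := by
  have hv0 : 0 < v := by linarith
  have hvq0 : 0 < q - v := by linarith
  have htv : 2 * |t| ≤ v / q := by
    have : 4 / q ≤ v / q := by gcongr
    calc 2 * |t| ≤ 2 * (2 / q) := by gcongr
      _ = 4 / q := by ring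
      _ ≤ _ := this
  have heq : 1 - v / q = (q - v) / q := by field_simp
  have htv' : 2 * |-t| ≤ 1 - v / q := by
    have : 4 / q ≤ (q - v) / q := by gcongr; linarith
    rw [abs_neg, heq]
    calc 2 * |t| ≤ 2 * (2 / q) := by gcongr
      _ = 4 / q := by ring
      _ ≤ _ := this
  have hw : 0 < v / q := by positivity
  have hw' : 0 < 1 - v / q := by rw [heq]; positivity
  have h1 := abs_log_add_sub_le hw htv
  have h2 := abs_log_add_sub_le hw' htv'
  have hta := abs_le.1 (le_refl |t|)
  rw [abs_neg] at htv'
  have hs1 : symLog (v / q + t) = -Real.log (v / q + t) - Real.log (1 - v / q + -t) := by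
    rw [symLog_of_mem ⟨by linarith, by linarith⟩]; ring_nf
  rw [hs1, symLog_of_mem ⟨hw.le, by linarith⟩]
  have hsq : ∀ w : ℝ, 0 < w → ∀ s : ℝ, |s| = |t| → 2 * (s / (w / q)) ^ 2 ≤ 8 * (w ^ 2)⁻¹ := by
    intro w hw s hs
    have : |s * q| ≤ 2 := by
      rw [abs_mul, hs, abs_of_pos hq]
      rwa [le_div_iff₀ hq] at ht
    have h5 : (s * q) ^ 2 ≤ 4 := by
      rw [← sq_abs]; nlinarith [abs_nonneg (s * q)]
    have h6 : s / (w / q) = (s * q) * w⁻¹ := by field_simp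
    have h7 : (0 : ℝ) ≤ (w ^ 2)⁻¹ := by positivity
    rw [h6, mul_pow, inv_pow]
    nlinarith
  have h3 := hsq v hv0 t rfl
  have h4 := hsq (q - v) hvq0 (-t) (abs_neg t)
  rw [heq] at h2 ⊢
  have e1 : t / (v / q) = t * q * (1 / v) := by field_simp
  have e2 : -t / ((q - v) / q) = -(t * q * (1 / (q - v))) := by field_simp
  have h1' := abs_le.1 (h1.trans h3)
  have h2' := abs_le.1 (h2.trans h4)
  rw [e1] at h1'
  rw [e2] at h2'
  rw [abs_le]; constructor <;> linarith [h1'.1, h1'.2, h2'.1, h2'.2]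

lemma fract_reflect_eq (a : ℤ) (q : ℕ) (hq : 0 < q) (γ : ℝ) {v : ℕ} (hv : v ≤ q) :
    Int.fract (γ + (q - v : ℕ) * ((a : ℝ) / q)) = Int.fract (γ + v * (((-a : ℤ) : ℝ) / q)) := by
  have hq' : (q : ℝ) ≠ 0 := by exact_mod_cast hq.ne'
  have : γ + (q - v : ℕ) * ((a : ℝ) / q) = γ + v * (((-a : ℤ) : ℝ) / q) + a := by
    push_cast [Nat.cast_sub hv]
    field_simp
    ring
  rw [this, Int.fract_add_intCast]

/-- The sawtooth sum against the derivative of `symLog`, from bounds on the sums against `1 / r`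
for `a` and `-a`. -/
lemma abs_sum_emod_mul_le {q : ℕ} (hq : 12 ≤ q) {a : ℤ} {C : ℝ}
    (hC : ∀ σ : ℤ, |σ| = 1 → ∀ γ : ℝ, ∀ B ≤ q,
      |∑ r ∈ Finset.Ico 1 B, (Int.fract (γ + r * ((σ * a : ℤ) / (q : ℝ))) - 1 / 2) / r| ≤ C)
    (g : ℤ) :
    |∑ v ∈ Finset.Ico 4 (q - 3),
      (((a * (v - g) % q : ℤ) : ℝ) / q - 1 / 2) * (1 / ((q : ℝ) - v) - 1 / v)| ≤ 4 * C := by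
  have hq0 : (q : ℝ) ≠ 0 := by exact_mod_cast (show q ≠ 0 by omega)
  have hC' : ∀ σ : ℤ, |σ| = 1 → ∀ γ : ℝ, |∑ r ∈ Finset.Ico 4 (q - 3),
      (Int.fract (γ + r * ((σ * a : ℤ) / (q : ℝ))) - 1 / 2) / r| ≤ 2 * C := by
    intro σ hσ γ
    have h1 := hC σ hσ γ (q - 3) (by omega)
    have h2 := hC σ hσ γ 4 (by omega)
    rw [← Finset.sum_Ico_consecutive _ (show 1 ≤ 4 by norm_num) (show 4 ≤ q - 3 by omega)] at h1
    rw [abs_le] at *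
    constructor <;> linarith
  set γ : ℝ := -(a * g) / q with hγ
  have h1 := hC' 1 (by norm_num) γ
  have h2 := hC' (-1) (by norm_num) γ
  have hf : ∀ v : ℕ, ((a * (v - g) % q : ℤ) : ℝ) / q = Int.fract (γ + v * ((a : ℝ) / q)) := by
    intro v
    rw [← Int.fract_div_intCast_eq_div_intCast_mod]
    congr 1
    rw [hγ]
    push_cast
    ring
  have hrefl : ∑ v ∈ Finset.Ico 4 (q - 3),
      (Int.fract (γ + v * ((a : ℝ) / q)) - 1 / 2) * (1 / ((q : ℝ) - v)) =
      ∑ v ∈ Finset.Ico 4 (q - 3), (Int.fract (γ + v * ((-1 * a : ℤ) / (q : ℝ))) - 1 / 2) / v := by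
    have h := Finset.sum_Ico_reflect (fun v : ℕ =>
      (Int.fract (γ + v * ((a : ℝ) / q)) - 1 / 2) * (1 / ((q : ℝ) - v))) 4
      (show q - 3 ≤ q + 1 by omega)
    rw [show q + 1 - (q - 3) = 4 by omega, show q + 1 - 4 = q - 3 by omega] at h
    rw [← h]
    refine Finset.sum_congr rfl fun v hv => ?_
    rw [Finset.mem_Ico] at hv
    rw [fract_reflect_eq a q (by omega) γ (by omega), Nat.cast_sub (by omega), neg_one_mul]
    ring
  simp only [hf]
  simp only [mul_sub]
  rw [Finset.sum_sub_distrib, hrefl]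
  simp only [one_mul] at h1
  simp only [mul_one_div]
  rw [abs_le] at *
  constructor <;> linarith

lemma sum_reflect_eq_zero {q : ℕ} (hq : 12 ≤ q) :
    ∑ v ∈ Finset.Ico 4 (q - 3), (1 / ((q : ℝ) - v) - 1 / v) = 0 := by
  have h := Finset.sum_Ico_reflect (fun v : ℕ => 1 / (v : ℝ)) 4 (show q - 3 ≤ q + 1 by omega)
  rw [show q + 1 - (q - 3) = 4 by omega, show q + 1 - 4 = q - 3 by omega] at h
  rw [Finset.sum_sub_distrib, ← h, sub_eq_zero]
  refine Finset.sum_congr rfl fun v hv => ?_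
  rw [Finset.mem_Ico] at hv
  rw [Nat.cast_sub (by omega)]

lemma sum_inv_sq_le {q : ℕ} (hq : 12 ≤ q) :
    ∑ v ∈ Finset.Ico 4 (q - 3), 8 * (((v : ℝ) ^ 2)⁻¹ + (((q : ℝ) - v) ^ 2)⁻¹) ≤ 32 := by
  have h := Finset.sum_Ico_reflect (fun v : ℕ => ((v : ℝ) ^ 2)⁻¹) 4 (show q - 3 ≤ q + 1 by omega)
  rw [show q + 1 - (q - 3) = 4 by omega, show q + 1 - 4 = q - 3 by omega] at h
  have h2 : ∑ v ∈ Finset.Ico 4 (q - 3), (((q : ℝ) - v) ^ 2)⁻¹ =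
      ∑ v ∈ Finset.Ico 4 (q - 3), ((v : ℝ) ^ 2)⁻¹ := by
    rw [← h]
    refine Finset.sum_congr rfl fun v hv => ?_
    rw [Finset.mem_Ico] at hv
    rw [Nat.cast_sub (by omega)]
  have h3 : ∑ v ∈ Finset.Ico 4 (q - 3), ((v : ℝ) ^ 2)⁻¹ ≤ 2 := by
    have := sum_Ioo_inv_sq_le (α := ℝ) 0 (q - 3)
    norm_num at this
    refine le_trans (Finset.sum_le_sum_of_subset_of_nonneg ?_ fun i _ _ => by positivity) this
    intro r hr
    simp only [Finset.mem_Ico, Finset.mem_Ioo] at *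
    omega
  rw [← Finset.mul_sum, Finset.sum_add_distrib, h2]
  linarith

lemma sum_range_ite_eq {q : ℕ} (hq : 12 ≤ q) (F : ℕ → ℝ) (B : ℝ) :
    ∑ v ∈ Finset.range q, (if (4 : ℤ) ≤ ((v : ℕ) : ℤ) ∧ ((v : ℕ) : ℤ) < q - 3 then F v else B) =
      ∑ v ∈ Finset.Ico 4 (q - 3), F v + 7 * B := by
  rw [Finset.range_eq_Ico, ← Finset.sum_Ico_consecutive _ (show 0 ≤ 4 by omega) (show 4 ≤ q by omega),
    ← Finset.sum_Ico_consecutive _ (show 4 ≤ q - 3 by omega) (show q - 3 ≤ q by omega)]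
  have h1 : ∑ v ∈ Finset.Ico 0 4, (if (4 : ℤ) ≤ ((v : ℕ) : ℤ) ∧ ((v : ℕ) : ℤ) < q - 3 then F v else B) = 4 * B := by
    rw [Finset.sum_congr rfl (g := fun _ => B)]
    · simp
    · intro v hv
      rw [Finset.mem_Ico] at hv
      rw [if_neg (by omega)]
  have h2 : ∑ v ∈ Finset.Ico (q - 3) q, (if (4 : ℤ) ≤ ((v : ℕ) : ℤ) ∧ ((v : ℕ) : ℤ) < q - 3 then F v else B) = 3 * B := by
    rw [Finset.sum_congr rfl (g := fun _ => B)]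
    · rw [Finset.sum_const, Nat.card_Ico, show q - (q - 3) = 3 by omega]
      simp
    · intro v hv
      rw [Finset.mem_Ico] at hv
      rw [if_neg (by omega)]
  have h3 : ∑ v ∈ Finset.Ico 4 (q - 3), (if (4 : ℤ) ≤ ((v : ℕ) : ℤ) ∧ ((v : ℕ) : ℤ) < q - 3 then F v else B) =
      ∑ v ∈ Finset.Ico 4 (q - 3), F v := by
    refine Finset.sum_congr rfl fun v hv => ?_
    rw [Finset.mem_Ico] at hv
    rw [if_pos (by omega)]
  rw [h1, h2, h3]
  ring

/-- Away from the singularities, the Birkhoff sum up to a denominator `q` stays at bounded distance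
from a quantity independent of the point. -/
lemma abs_birkhoffRot_sub_le {q : ℕ} (hq : 12 ≤ q) {α θ : ℝ} {p a : ℤ} (hap : a * p ≡ 1 [ZMOD q])
    (hα : α = p / q + θ) (hθ : |θ| * q ^ 2 ≤ 1) {C : ℝ}
    (hC : ∀ σ : ℤ, |σ| = 1 → ∀ γ : ℝ, ∀ B ≤ q,
      |∑ r ∈ Finset.Ico 1 B, (Int.fract (γ + r * ((σ * a : ℤ) / (q : ℝ))) - 1 / 2) / r| ≤ C)
    {G : ℝ → ℝ} (hper : Function.Periodic G 1) {M : ℝ} (hM : 0 ≤ M)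
    (hG : ∀ x y, |G x - G y| ≤ M * |x - y|) {δ x : ℝ} (hδ : 0 < δ)
    (hsep : ∀ j : ℕ, j < q → ∀ l : ℤ, δ / q ≤ |x + j * α - l|) :
    |birkhoffRot α (symLogRoof G) q x -
      ∑ v ∈ Finset.range q, ((if (4 : ℤ) ≤ v ∧ (v : ℤ) < q - 3 then symLog (v / q)
        else Real.log q) + G (v / q))| ≤
      7 * (Real.log 6 + |Real.log δ| + Real.log 2) + 32 + 4 * C + 2 * M := by
  have hq0 : (0 : ℝ) < q := by exact_mod_cast (show 0 < q by omega)
  have hqz : (0 : ℤ) < q := by omega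
  have habs : ∀ y : ℝ, |y| * q = |y * q| := fun y => by rw [abs_mul, Nat.abs_cast]
  have hq12 : (12 : ℝ) ≤ q := by exact_mod_cast hq
  set g : ℤ := ⌊q * x⌋ with hg
  set κ : ℝ := q * x - g with hκ
  have hκ0 : 0 ≤ κ := sub_nonneg.2 (Int.floor_le _)
  have hκ1 : κ < 1 := by linarith [Int.lt_floor_add_one (q * x)]
  set b : ℝ := Real.log 6 + |Real.log δ| + Real.log 2 with hb
  set W : ℤ → ℝ := fun v => (if 4 ≤ v ∧ v < q - 3 then symLog (v / q) else Real.log q) + G (v / q)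
    with hW
  set T : ℤ → ℤ → ℝ := fun j v =>
    if 4 ≤ v ∧ v < q - 3 then (κ / q + j * θ) * q * (1 / ((q : ℝ) - v) - 1 / v) else 0 with hT
  set E : ℤ → ℝ := fun v =>
    if 4 ≤ v ∧ v < q - 3 then 8 * (((v : ℝ) ^ 2)⁻¹ + (((q : ℝ) - v) ^ 2)⁻¹) else b with hE
  have hterm : ∀ j ∈ Finset.range q, |symLogRoof G (x + j * α) - W ((g + j * p) % q) -
      T j ((g + j * p) % q)| ≤ E ((g + j * p) % q) + 2 * M / q := by
    intro j hj
    rw [Finset.mem_range] at hj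
    have hjr : (j : ℝ) ≤ q := by exact_mod_cast hj.le
    set v : ℤ := (g + j * p) % q with hv
    have hv0 : 0 ≤ v := Int.emod_nonneg _ hqz.ne'
    have hv1 : v < q := Int.emod_lt_of_pos _ hqz
    have hdiv : ((g + j * p : ℤ) : ℝ) = q * ((g + j * p) / q : ℤ) + v := by
      rw [hv]; exact_mod_cast (Int.mul_ediv_add_emod (g + j * p) q).symm
    set N : ℤ := (g + j * p) / q with hN
    push_cast at hdiv
    set t : ℝ := κ / q + j * θ with ht
    have htq : |t * q - κ| ≤ 1 := by
      have : t * q - κ = j * (θ * q) := by rw [ht]; field_simp; ring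
      rw [this, abs_mul, abs_mul, Nat.abs_cast, Nat.abs_cast]
      calc (j : ℝ) * (|θ| * q) ≤ q * (|θ| * q) := by gcongr
        _ ≤ 1 := by linarith
    have htq' := abs_le.1 htq
    have htabs : |t| ≤ 2 / q := by
      rw [le_div_iff₀ hq0, habs, abs_le]
      constructor <;> linarith
    have hx : x + j * α - N = v / q + t := by
      rw [hα, ht]
      field_simp
      rw [hκ]
      linarith
    have hGt : |G (x + j * α) - G (v / q)| ≤ 2 * M / q := by
      have : G (x + j * α) = G (v / q + t) := by
        rw [← hx]; simpa using (hper.sub_zsmul_eq N (x := x + j * α)).symm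
      rw [this]
      refine (hG _ _).trans ?_
      rw [add_sub_cancel_left]
      calc M * |t| ≤ M * (2 / q) := by gcongr
        _ = 2 * M / q := by ring
    have hS : |symLog (x + j * α) - (if 4 ≤ v ∧ v < q - 3 then symLog (v / q) else Real.log q) -
        T j v| ≤ E v := by
      by_cases hfar : 4 ≤ v ∧ v < q - 3
      · simp only [hT, hE, if_pos hfar]
        rw [← symLog_sub_intCast _ N, hx]
        push_cast
        refine abs_symLog_add_sub_le hq0 (by exact_mod_cast hfar.1) ?_ htabs
        have : v ≤ q - 4 := by omega
        exact_mod_cast this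
      · simp only [hT, hE, if_neg hfar, sub_zero]
        obtain ⟨l, hl⟩ : ∃ l : ℤ, |x + j * α - l| ≤ 6 / q := by
          by_cases h4 : v < 4
          · refine ⟨N, ?_⟩
            have h1 : (0 : ℝ) ≤ v := by exact_mod_cast hv0
            have h2 : (v : ℝ) < 4 := by exact_mod_cast h4
            rw [hx, le_div_iff₀ hq0, habs, add_mul,
              div_mul_cancel₀ _ hq0.ne', abs_le]
            constructor <;> linarith
          · refine ⟨N + 1, ?_⟩
            have h1 : (q : ℝ) - 3 ≤ v := by exact_mod_cast (by omega : (q : ℤ) - 3 ≤ v)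
            have h2 : (v : ℝ) < q := by exact_mod_cast hv1
            have : x + j * α - (N + 1 : ℤ) = v / q + t - 1 := by push_cast; linarith
            rw [this, le_div_iff₀ hq0, habs, sub_mul,
              add_mul, div_mul_cancel₀ _ hq0.ne', abs_le]
            constructor <;> linarith
        rw [← symLog_sub_intCast _ l]
        exact abs_symLog_sub_log_le hδ hq12 (hsep j hj l) hl
    have : symLogRoof G (x + j * α) - W v - T j v =
        (symLog (x + j * α) - (if 4 ≤ v ∧ v < q - 3 then symLog (v / q) else Real.log q) - T j v) +
        (G (x + j * α) - G (v / q)) := by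
      simp only [hW, symLogRoof]; ring
    rw [this]
    exact (abs_add_le _ _).trans (add_le_add hS hGt)
  have hWs := sum_range_emod_eq (by omega) g hap (fun _ v => W v)
  have hEs := sum_range_emod_eq (by omega) g hap (fun _ v => E v)
  have hTs := sum_range_emod_eq (by omega) g hap T
  have hE' : ∑ v ∈ Finset.range q, E v ≤ 32 + 7 * b := by
    simp only [hE]
    push_cast
    rw [sum_range_ite_eq hq]
    linarith [sum_inv_sq_le hq]
  have hT' : |∑ v ∈ Finset.range q, T ((a * (v - g)) % q) v| ≤ 4 * C := by
    simp only [hT]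
    have := sum_range_ite_eq hq (fun v : ℕ =>
      (κ / q + ((a * (v - g)) % q : ℤ) * θ) * q * (1 / ((q : ℝ) - v) - 1 / v)) 0
    push_cast at this ⊢
    rw [this, mul_zero, add_zero]
    have hs : ∑ v ∈ Finset.Ico 4 (q - 3),
        (κ / q + ((a * (v - g)) % q : ℤ) * θ) * q * (1 / ((q : ℝ) - v) - 1 / v) =
        θ * q ^ 2 * ∑ v ∈ Finset.Ico 4 (q - 3),
          (((a * (v - g) % q : ℤ) : ℝ) / q - 1 / 2) * (1 / ((q : ℝ) - v) - 1 / v) +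
        (κ + θ * q ^ 2 / 2) * ∑ v ∈ Finset.Ico 4 (q - 3), (1 / ((q : ℝ) - v) - 1 / v) := by
      rw [Finset.mul_sum, Finset.mul_sum, ← Finset.sum_add_distrib]
      refine Finset.sum_congr rfl fun v _ => ?_
      rw [← mul_assoc, ← add_mul]
      congr 1
      field_simp
      ring
    rw [hs, sum_reflect_eq_zero hq, mul_zero, add_zero, abs_mul]
    have h1 := abs_sum_emod_mul_le hq hC g
    rw [abs_mul, abs_of_nonneg (show (0 : ℝ) ≤ (q : ℝ) ^ 2 by positivity)]
    calc _ ≤ 1 * (4 * C) := mul_le_mul hθ h1 (abs_nonneg _) zero_le_one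
      _ = 4 * C := one_mul _
  have h1 := (Finset.abs_sum_le_sum_abs _ _).trans (Finset.sum_le_sum hterm)
  rw [Finset.sum_add_distrib, Finset.sum_const, Finset.card_range, nsmul_eq_mul,
    mul_div_cancel₀ _ hq0.ne', hEs, Finset.sum_sub_distrib, Finset.sum_sub_distrib, hWs, hTs] at h1
  have hWeq : ∑ v ∈ Finset.range q, ((if (4 : ℤ) ≤ v ∧ (v : ℤ) < q - 3 then symLog (v / q)
        else Real.log q) + G (v / q)) = ∑ v ∈ Finset.range q, W v := by
    simp only [hW]
    push_cast
    rfl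
  rw [hWeq, birkhoffRot]
  rw [abs_le] at h1 hT' ⊢
  constructor <;> linarith

lemma exists_lipschitz_of_periodic {g : ℝ → ℝ} (hper : Function.Periodic g 1)
    (hg : ContDiff ℝ 1 g) : ∃ M : ℝ, 0 ≤ M ∧ ∀ x y, |g x - g y| ≤ M * |x - y| := by
  have hcont : Continuous (deriv g) := hg.continuous_deriv le_rfl
  have hdper : Function.Periodic (deriv g) 1 := by
    intro x
    rw [← deriv_comp_add_const g 1 x]
    congr 1
    funext y
    exact hper y
  obtain ⟨M, hM⟩ := isCompact_Icc.exists_bound_of_continuousOn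
    (s := Set.Icc (0 : ℝ) 1) hcont.continuousOn
  have hb : ∀ x, ‖deriv g x‖ ≤ M := by
    intro x
    have : deriv g x = deriv g (Int.fract x) := by
      rw [← Int.self_sub_floor]
      simpa using (hdper.sub_zsmul_eq ⌊x⌋ (x := x)).symm
    rw [this]
    exact hM _ ⟨Int.fract_nonneg _, (Int.fract_lt_one _).le⟩
  refine ⟨M, (norm_nonneg _).trans (hb 0), fun x y => ?_⟩
  exact Convex.norm_image_sub_le_of_norm_deriv_le
    (fun z _ => (hg.differentiable one_ne_zero) z) (fun z _ => hb z) convex_univ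
    (Set.mem_univ y) (Set.mem_univ x)

/-- The reference point `1 / (2q)` stays at distance at least `1 / (4q)` from the singularities. -/
lemma le_abs_midpoint_add_sub {q : ℕ} (hq : 0 < q) {α θ : ℝ} {p : ℤ} (hα : α = p / q + θ)
    (hθ : |θ| * q ^ 2 ≤ 1 / 4) {j : ℕ} (hj : j < q) (l : ℤ) :
    1 / 4 / (q : ℝ) ≤ |1 / (2 * (q : ℝ)) + j * α - l| := by
  have hq0 : (0 : ℝ) < q := by exact_mod_cast hq
  have hjr : (j : ℝ) ≤ q := by exact_mod_cast hj.le
  have hη : |j * (θ * q)| ≤ 1 / 4 := by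
    rw [abs_mul, abs_mul, Nat.abs_cast, Nat.abs_cast]
    calc (j : ℝ) * (|θ| * q) ≤ q * (|θ| * q) := by gcongr
      _ ≤ 1 / 4 := by linarith
  rw [div_le_iff₀ hq0, ← Nat.abs_cast q, ← abs_mul, Nat.abs_cast]
  have heq : (1 / (2 * (q : ℝ)) + j * α - l) * q =
      1 / 2 + ((j * p - l * q : ℤ) : ℝ) + j * (θ * q) := by
    rw [hα]; push_cast; field_simp; ring
  rw [heq]
  have hη' := abs_le.1 hη
  rcases le_or_gt 0 (j * p - l * q : ℤ) with h | h
  · have : (0 : ℝ) ≤ ((j * p - l * q : ℤ) : ℝ) := by exact_mod_cast h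
    exact le_abs.2 (Or.inl (by linarith))
  · have : ((j * p - l * q : ℤ) : ℝ) ≤ -1 := by exact_mod_cast (by omega : (j * p - l * q : ℤ) ≤ -1)
    exact le_abs.2 (Or.inr (by linarith))

/-- If `x` is close to a singularity of the Birkhoff sum up to time `q`, then its translates by
nonzero multiples of `q α` are not. -/
lemma le_abs_translate_add_sub {α δ x : ℝ} {q q' L : ℕ} (hL : 1 ≤ L) (hq : 0 < q)
    (hq' : 100 * L * q ≤ q')
    (hbest : ∀ m : ℤ, m ≠ 0 → 2 * |m| ≤ q' → ∀ l : ℤ, 1 / (2 * (q' : ℝ)) ≤ |m * α - l|)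
    (hδ : 2 * (δ / q) ≤ 1 / (2 * (q' : ℝ))) {j : ℕ} (hj : j < q) {l : ℤ}
    (hjl : |x + j * α - l| < δ / q) {i : ℤ} (hi0 : i ≠ 0) (hiL : |i| ≤ L)
    {j' : ℕ} (hj' : j' < q) (l' : ℤ) :
    δ / q ≤ |x + ((i * (q : ℤ) : ℤ) : ℝ) * α + j' * α - l'| := by
  by_contra! hcon
  have hqz : (0 : ℤ) < q := by exact_mod_cast hq
  have hm0 : i * q + j' - j ≠ 0 := by
    intro h0
    have h1 : i * q = j - j' := by linarith
    have h2 : |i * q| < q := by rw [h1, abs_lt]; constructor <;> omega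
    rw [abs_mul, Nat.abs_cast] at h2
    have := Int.one_le_abs hi0
    nlinarith
  have hm1 : 2 * |i * q + j' - j| ≤ (q' : ℤ) := by
    have h1 : |i * q + j' - j| ≤ |i * q| + q := by
      have : |(j' : ℤ) - j| ≤ q := by rw [abs_le]; constructor <;> omega
      rw [add_sub_assoc]
      exact (abs_add_le _ _).trans (by gcongr)
    rw [abs_mul, Nat.abs_cast] at h1
    have h2 : 100 * (L : ℤ) * q ≤ q' := by exact_mod_cast hq'
    have h3 : |i| * (q : ℤ) ≤ L * q := mul_le_mul_of_nonneg_right hiL hqz.le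
    have h4 : 1 * (q : ℤ) ≤ L * q := mul_le_mul_of_nonneg_right (by exact_mod_cast hL) hqz.le
    linarith
  have h1 := hbest _ hm0 hm1 (l' - l)
  have h2 : ((i * q + j' - j : ℤ) : ℝ) * α - (l' - l : ℤ) =
      (x + ((i * (q : ℤ) : ℤ) : ℝ) * α + j' * α - l') - (x + j * α - l) := by
    push_cast; ring
  rw [h2] at h1
  have h3 := (abs_sub _ _).trans_lt (add_lt_add hcon hjl)
  linarith

/-- For `α ∈ 𝒞_{K,L}` (`L > K`) with associated sequence `(n_k)` and
`f(x) = -log x - log(1-x) + g(x)` (`g ∈ C³(𝕋)`, `g > 0`), there are `k₀` and `b₀ > 0` such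
that for all `k ≥ k₀`, `b ≥ b₀`: if `|S_{q_{n_k}}(f)(x) - c_k| ≥ b` then for every
`i ∈ {-L,…,-1,1,…,L}` one has `|S_{q_{n_k}}(f)(R_α^{i q_{n_k}}x) - c_k| ≤ b/(2L)`. -/
theorem statement12 (K L : ℕ) (hKL : K < L)
    (α : ℝ) (hirr : Irrational α) (hα : α ∈ Set.Ioo (0 : ℝ) 1)
    (nk : ℕ → ℕ) (hnk : StrictMono nk) (c : ℝ) (hc : 0 < c)
    (hdio1 : ∀ k n : ℕ, 1 ≤ n → n ≤ nk k →
      (cfA α (nk k + 1 - n) : ℝ) ≤ Real.exp (c * n))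
    (hdio2 : ∀ k : ℕ, 100 * (K ^ 2 + L ^ 2) < cfA α (nk k + 1) ∧
      cfA α (nk k + 1) < 200 * (K ^ 2 + L ^ 2))
    (g : ℝ → ℝ) (hgper : Function.Periodic g 1) (hg : ContDiff ℝ 3 g) (hgpos : ∀ x, 0 < g x) :
    ∃ k₀ : ℕ, ∃ b₀ > (0 : ℝ), ∀ k ≥ k₀, ∀ b ≥ b₀, ∀ x : ℝ,
      b ≤ |birkhoffRot α (symLogRoof g) (cfQ α (nk k)) x
            - birkhoffRot α (symLogRoof g) (cfQ α (nk k)) (1 / (2 * (cfQ α (nk k) : ℝ)))| →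
      ∀ i : ℤ, i ≠ 0 → |i| ≤ (L : ℤ) →
        |birkhoffRot α (symLogRoof g) (cfQ α (nk k))
              (x + ((i * (cfQ α (nk k) : ℤ) : ℤ) : ℝ) * α)
            - birkhoffRot α (symLogRoof g) (cfQ α (nk k)) (1 / (2 * (cfQ α (nk k) : ℝ)))|
          ≤ b / (2 * (L : ℝ)) := by
  have hL : 1 ≤ L := by omega
  have hLr : (1 : ℝ) ≤ L := by exact_mod_cast hL
  obtain ⟨C, hC⟩ := exists_bound_sum_fract_cfQ hirr hc
  obtain ⟨M, hM0, hM⟩ := exists_lipschitz_of_periodic hgper (hg.of_le (by norm_num))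
  set S : ℝ := 200 * (K ^ 2 + L ^ 2) with hS
  have hS1 : 1 ≤ S := by
    have : (0 : ℝ) ≤ K ^ 2 := by positivity
    nlinarith
  set δ : ℝ := 1 / (4 * S) with hδ
  have hδ0 : 0 < δ := by positivity
  have hδ1 : δ ≤ 1 / 4 := by
    rw [hδ]; exact one_div_le_one_div_of_le (by norm_num) (by linarith)
  set D : ℝ := 7 * (Real.log 6 + |Real.log δ| + Real.log 2) + 32 + 4 * C + 2 * M with hD
  set D' : ℝ := |D| with hD'
  have hDD : D ≤ D' := le_abs_self D
  have hD0 : 0 ≤ D' := abs_nonneg D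
  refine ⟨12, (2 * D' + 1) * (2 * L), by positivity, fun k hk b hb x hx i hi0 hiL => ?_⟩
  have hn : 12 ≤ nk k := hk.trans hnk.le_apply
  obtain ⟨hA1, hA2⟩ := hdio2 k
  have hCn := hC (nk k) (by omega) (hdio1 k)
  obtain ⟨N, hN⟩ := Nat.exists_eq_add_of_le' (show 1 ≤ nk k by omega)
  have hq12 : 12 ≤ cfQ α (nk k) := hn.trans (le_cfQ hirr _)
  have hmul := cfA_mul_cfQ_le α (nk k)
  have hsucc := cfQ_succ_le hirr (nk k)
  have hdist := abs_cfQ_mul_sub_cfP_le hirr hα (nk k)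
  have hbest := fun (m : ℤ) (h0 : m ≠ 0) => one_div_le_abs_mul_sub hirr hα (n := nk k + 1) h0
  have hdet := cfQ_mul_cfP_sub α N
  rw [← hN] at hdet
  rw [show nk k - 1 = N by omega] at hCn
  set q : ℕ := cfQ α (nk k) with hq
  set q' : ℕ := cfQ α (nk k + 1) with hq'
  set p : ℤ := (cfP α (nk k) : ℤ) with hp
  have hq0 : (0 : ℝ) < q := by exact_mod_cast (show 0 < q by omega)
  -- size of the next denominator
  have hq'1 : 100 * L * q ≤ q' := by
    have h1 : 100 * L ≤ cfA α (nk k + 1) := by nlinarith [Nat.zero_le (K ^ 2)]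
    exact (Nat.mul_le_mul_right q h1).trans hmul
  have hq'2 : (q' : ℝ) ≤ S * q := by
    have h1 : q' ≤ 200 * (K ^ 2 + L ^ 2) * q := hsucc.trans (Nat.mul_le_mul_right q hA2)
    rw [hS]; exact_mod_cast h1
  have hq'0 : (0 : ℝ) < q' := by exact_mod_cast cfQ_pos hirr _
  have hq'3 : 100 * (q : ℝ) ≤ q' := by
    have : 100 * q ≤ q' := le_trans (by nlinarith) hq'1
    exact_mod_cast this
  -- the rational approximation
  set θ : ℝ := α - p / q with hθdef
  have hαθ : α = p / q + θ := by rw [hθdef]; ring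
  have hθ : |θ| * q ^ 2 ≤ 1 / 4 := by
    have h1 : |θ| * q = |(q : ℝ) * α - cfP α (nk k)| := by
      rw [hθdef, hp, ← Nat.abs_cast q, ← abs_mul, Nat.abs_cast]
      congr 1
      push_cast
      field_simp
    rw [pow_two, ← mul_assoc, h1]
    have h2 := abs_nonneg ((q : ℝ) * α - cfP α (nk k))
    nlinarith
  have hσ : |((-1) ^ N : ℤ)| = 1 := by rw [abs_pow, abs_neg, abs_one, one_pow]
  have hap : ((-1) ^ N * cfQ α N : ℤ) * p ≡ 1 [ZMOD q] := by
    have hsq : ((-1) ^ N : ℤ) * (-1) ^ N = 1 := by rw [← mul_pow]; norm_num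
    refine Int.modEq_iff_dvd.2 ⟨-((-1) ^ N * cfP α N), ?_⟩
    linear_combination (-(-1) ^ N : ℤ) * hdet - hsq
  have hCa : ∀ σ : ℤ, |σ| = 1 → ∀ γ : ℝ, ∀ B ≤ q,
      |∑ r ∈ Finset.Ico 1 B,
        (Int.fract (γ + r * ((σ * ((-1) ^ N * cfQ α N) : ℤ) / (q : ℝ))) - 1 / 2) / r| ≤ C := by
    intro σ h1 γ B hB
    rw [← mul_assoc]
    exact hCn _ (by rw [abs_mul, h1, hσ, mul_one]) γ B hB
  set ck : ℝ := birkhoffRot α (symLogRoof g) q (1 / (2 * (q : ℝ))) with hck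
  have hbound := fun (y : ℝ) (hy : ∀ j : ℕ, j < q → ∀ l : ℤ, δ / q ≤ |y + j * α - l|) =>
    abs_birkhoffRot_sub_le hq12 hap hαθ (hθ.trans (by norm_num)) hCa hgper hM0 hM hδ0 hy
  have hmid := hbound (1 / (2 * (q : ℝ))) fun j hj l =>
    le_trans (by gcongr) (le_abs_midpoint_add_sub (by omega) hαθ hθ hj l)
  have hclose : ∀ y : ℝ, (∀ j : ℕ, j < q → ∀ l : ℤ, δ / q ≤ |y + j * α - l|) →
      |birkhoffRot α (symLogRoof g) q y - ck| ≤ 2 * D' := by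
    intro y hy
    have h1 := hbound y hy
    rw [abs_le] at *
    constructor <;> linarith
  have hb1 : 2 * D' + 1 ≤ b := le_trans (by nlinarith) hb
  -- `x` is close to a singularity
  obtain ⟨j, hj, l, hjl⟩ : ∃ j : ℕ, j < q ∧ ∃ l : ℤ, |x + j * α - l| < δ / q := by
    by_contra! hcon
    have := hclose x hcon
    linarith
  have hδq : 2 * (δ / q) ≤ 1 / (2 * (q' : ℝ)) := by
    have : 2 * (δ / q) = 1 / (2 * (S * q)) := by rw [hδ]; field_simp; norm_num
    rw [this]
    gcongr
  refine (hclose _ fun j' hj' l' => le_abs_translate_add_sub hL (by omega) hq'1 hbest hδq hj hjl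
    hi0 hiL hj' l').trans ?_
  rw [le_div_iff₀ (by positivity)]
  nlinarith
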